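/- Let Γ ⊆ Iso(ℝⁿ_s) be a subgroup having the Wolf properties whose centraliser C in Iso(ℝⁿ_s) has an open orbit D ⊆ ℝⁿ. If s ≤ 3 (i.e. s ∈ {0,1,2,3}), then D is translationally isotropic, i.e. T(D)^⊥ ⊆ T(D). -/

import Mathlib

noncomputable section

/-- `ℝⁿ` as a coordinate space. -/
abbrev E (n : ℕ) : Type := Fin n → ℝ

/-- The standard symmetric bilinear form of signature `(n-s, s)` on `ℝⁿ`. -/
def B (n s : ℕ) : LinearMap.BilinForm ℝ (E n) :=
  LinearMap.mk₂ ℝ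
    (fun x y => ∑ i : Fin n, (if (i : ℕ) < n - s then x i * y i else -(x i * y i)))
    (by
      intro x x' y
      rw [← Finset.sum_add_distrib]
      refine Finset.sum_congr rfl fun i _ => ?_
      by_cases h : (i : ℕ) < n - s <;> simp [h] <;> ring)
    (by
      intro c x y
      rw [Finset.smul_sum]
      refine Finset.sum_congr rfl fun i _ => ?_
      by_cases h : (i : ℕ) < n - s <;> simp [h] <;> ring)
    (by
      intro x y y'
      rw [← Finset.sum_add_distrib]
      refine Finset.sum_congr rfl fun i _ => ?_
      by_cases h : (i : ℕ) < n - s <;> simp [h] <;> ring)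
    (by
      intro c x y
      rw [Finset.smul_sum]
      refine Finset.sum_congr rfl fun i _ => ?_
      by_cases h : (i : ℕ) < n - s <;> simp [h] <;> ring)

/-- Orthogonal complement (w.r.t. the form `B n s`) of a set `S ⊆ ℝⁿ`. -/
def perp (n s : ℕ) (S : Set (E n)) : Set (E n) :=
  {x | ∀ w ∈ S, B n s x w = 0}

/-- A set of vectors is totally isotropic if the form vanishes identically on it. -/
def TotallyIsotropicSet (n s : ℕ) (U : Set (E n)) : Prop :=
  ∀ u ∈ U, ∀ u' ∈ U, B n s u u' = 0

/-- The set `T(D)` of translations preserving `D`. -/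
def TransSet (n : ℕ) (D : Set (E n)) : Set (E n) :=
  {v | ∀ x ∈ D, v + x ∈ D}

/-- `D` is translationally isotropic if `T(D)^⊥ ⊆ T(D)`. -/
def TranslationallyIsotropic (n s : ℕ) (D : Set (E n)) : Prop :=
  perp n s (TransSet n D) ⊆ TransSet n D

/-- The group of invertible affine transformations of `ℝⁿ`. -/
abbrev Aff (n : ℕ) : Type := (E n) ≃ᵃ[ℝ] (E n)

/-- The affine isometries of `ℝⁿ_s`: affine transformations whose linear part
preserves the bilinear form. -/
def Iso (n s : ℕ) : Set (Aff n) :=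
  {g | ∀ x y : E n, B n s (g.linear x) (g.linear y) = B n s x y}

/-- For `γ = (I + A, v)`, the matrix `A`, i.e. the linear part minus the identity. -/
def linA (n : ℕ) (γ : Aff n) : (E n) →ₗ[ℝ] (E n) :=
  γ.linear.toLinearMap - LinearMap.id

/-- The translation part `v` of an affine transformation. -/
def transPart (n : ℕ) (γ : Aff n) : E n := γ 0

/-- The Wolf properties of a single affine isometry `γ = (I + A, v)`:
`A² = 0`, `Av = 0`, `im A` totally isotropic, `v ⊥ im A`,
`im A = (ker A)^⊥` and `ker A = (im A)^⊥`. -/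
def WolfElt (n s : ℕ) (γ : Aff n) : Prop :=
  linA n γ ∘ₗ linA n γ = 0 ∧
  linA n γ (transPart n γ) = 0 ∧
  TotallyIsotropicSet n s (LinearMap.range (linA n γ) : Set (E n)) ∧
  transPart n γ ∈ perp n s (LinearMap.range (linA n γ) : Set (E n)) ∧
  (LinearMap.range (linA n γ) : Set (E n)) = perp n s (LinearMap.ker (linA n γ) : Set (E n)) ∧
  (LinearMap.ker (linA n γ) : Set (E n)) = perp n s (LinearMap.range (linA n γ) : Set (E n))

/-- The linear holonomy group `Hol(Γ)` (the group of linear parts) is abelian. -/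
def HolAbelian (n : ℕ) (Γ : Subgroup (Aff n)) : Prop :=
  ∀ γ₁ ∈ Γ, ∀ γ₂ ∈ Γ,
    γ₁.linear.toLinearMap ∘ₗ γ₂.linear.toLinearMap =
      γ₂.linear.toLinearMap ∘ₗ γ₁.linear.toLinearMap

/-- The centraliser of `Γ` in `Iso(ℝⁿ_s)`. -/
def CentrIso (n s : ℕ) (Γ : Subgroup (Aff n)) : Set (Aff n) :=
  {g ∈ Iso n s | ∀ γ ∈ Γ, g * γ = γ * g}

/-- The subspace `U_Γ = ∑_{(I+A,v) ∈ Γ} im A`. -/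
def UGamma (n : ℕ) (Γ : Subgroup (Aff n)) : Submodule ℝ (E n) :=
  ⨆ γ ∈ Γ, LinearMap.range (linA n γ)

/-- The set `U₀ = U_Γ ∩ U_Γ^⊥`. -/
def U0 (n s : ℕ) (Γ : Subgroup (Aff n)) : Set (E n) :=
  (UGamma n Γ : Set (E n)) ∩ perp n s (UGamma n Γ : Set (E n))

/-- The translation `τ_u : x ↦ u + x` as an affine transformation. -/
def τ (n : ℕ) (u : E n) : Aff n := AffineEquiv.constVAdd ℝ (E n) u


lemma aux_B_apply (n s : ℕ) (x y : E n) : B n s x y =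
    ∑ i : Fin n, (if (i : ℕ) < n - s then x i * y i else -(x i * y i)) := rfl

lemma aux_B_symm (n s : ℕ) (x y : E n) : B n s x y = B n s y x := by
  simp only [aux_B_apply, mul_comm]

lemma aux_B_nondeg (n s : ℕ) (x : E n) (h : ∀ y, B n s x y = 0) : x = 0 := by
  funext i
  have := h (Pi.single i 1)
  rw [aux_B_apply, Finset.sum_eq_single i] at this
  · by_cases hi : (i : ℕ) < n - s <;> simpa [hi] using this
  · intro j _ hj
    simp [hj]
  · simp

lemma aux_isotropic_zero (n s : ℕ) (x : E n) (h : B n s x x = 0)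
    (h0 : ∀ i : Fin n, ¬ (i : ℕ) < n - s → x i = 0) : x = 0 := by
  rw [aux_B_apply, Finset.sum_eq_zero_iff_of_nonneg] at h
  · funext i
    by_cases hi : (i : ℕ) < n - s
    · simpa [hi] using h i (Finset.mem_univ i)
    · exact h0 i hi
  · intro i _
    by_cases hi : (i : ℕ) < n - s
    · simp [hi, mul_self_nonneg]
    · simp [hi, h0 i hi]

lemma aux_index (n s : ℕ) (hs : s ≤ 3) (L : (Fin 4 → ℝ) →ₗ[ℝ] E n)
    (h : ∀ c, B n s (L c) (L c) = 0) : ∃ c, c ≠ 0 ∧ L c = 0 := by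
  let P : E n →ₗ[ℝ] ({i : Fin n // ¬ (i : ℕ) < n - s} → ℝ) :=
    LinearMap.funLeft ℝ ℝ Subtype.val
  have hcard : Fintype.card {i : Fin n // ¬ (i : ℕ) < n - s} ≤ s := by
    have hinj : Function.Injective
        (fun i : {i : Fin n // ¬ (i : ℕ) < n - s} =>
          (⟨i.1.1 - (n - s), by have := i.2; have := i.1.2; omega⟩ : Fin s)) := by
      rintro ⟨i, hi⟩ ⟨j, hj⟩ hij
      simp only [Fin.mk.injEq] at hij
      ext
      simp only
      omega
    simpa using Fintype.card_le_of_injective _ hinj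
  have hk : LinearMap.ker (P ∘ₗ L) ≠ ⊥ := by
    apply LinearMap.ker_ne_bot_of_finrank_lt
    simp only [Module.finrank_fintype_fun_eq_card, Fintype.card_fin]
    omega
  obtain ⟨c, hc, hc0⟩ := (Submodule.ne_bot_iff _).1 hk
  refine ⟨c, hc0, aux_isotropic_zero n s _ (h c) fun i hi => ?_⟩
  exact congrFun (LinearMap.mem_ker.1 hc) ⟨i, hi⟩

lemma aux_skew (n s : ℕ) (γ : Aff n) (hi : γ ∈ Iso n s) (hw : WolfElt n s γ) (x y : E n) :
    B n s (linA n γ x) y = - B n s x (linA n γ y) := by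
  have h1 := hi x y
  have h2 := hw.2.2.1 (linA n γ x) ⟨x, rfl⟩ (linA n γ y) ⟨y, rfl⟩
  have e : ∀ z, γ.linear z = z + linA n γ z := fun z => by simp [linA]
  rw [e, e] at h1
  simp only [map_add, LinearMap.add_apply] at h1
  linarith

lemma aux_ring {R : Type*} [Ring R] (a b : R) (ha : a * a = 0) (hb : b * b = 0)
    (h : (a + b + a * b) * (a + b + a * b) = 0) :
    a * b = - (b * a) ∧ b * a * b = 0 := by
  have e : (a + b + a * b) * (a + b + a * b) =
      a * b + b * a + b * a * b + a * b * a + a * b * a * b := by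
    have e0 : (a + b + a * b) * (a + b + a * b) =
      a * a + a * b + (a * a) * b + b * a + b * b + b * a * b + a * b * a + a * (b * b)
        + a * b * a * b := by noncomm_ring
    rw [e0, ha, hb]; noncomm_ring
  rw [e] at h
  have h1 : a * b * a + a * b * a * b = 0 := by
    have e1 : a * (a * b + b * a + b * a * b + a * b * a + a * b * a * b) =
      (a * a) * b + a * b * a + a * b * a * b + (a * a) * (b * a) + (a * a) * (b * a * b) := by
      noncomm_ring
    rw [h, ha] at e1
    simpa using e1.symm
  have h2 : a * b * a * b = 0 := by
    have e2 : (a * b * a + a * b * a * b) * b = a * b * a * b + a * b * a * (b * b) := by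
      noncomm_ring
    rw [h1, hb] at e2
    simpa using e2.symm
  have h3 : a * b * a = 0 := by simpa [h2] using h1
  have h4 : a * b + b * a + b * a * b = 0 := by
    simpa [h2, h3] using h
  have h5 : b * a * b = 0 := by
    have e3 : b * (a * b + b * a + b * a * b) = b * a * b + (b * b) * a + (b * b) * (a * b) := by
      noncomm_ring
    rw [h4, hb] at e3
    simpa using e3.symm
  refine ⟨?_, h5⟩
  rw [h5, add_zero] at h4
  exact eq_neg_of_add_eq_zero_left h4

lemma aux_prod_zero (n s : ℕ) (hs : s ≤ 3) (Γ : Subgroup (Aff n))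
    (hΓIso : (Γ : Set (Aff n)) ⊆ Iso n s) (hWolf : ∀ γ ∈ Γ, WolfElt n s γ)
    (g : Aff n) (hg : g ∈ Γ) (g' : Aff n) (hg' : g' ∈ Γ) (x y : E n) :
    B n s (linA n g (linA n g' x)) y = 0 := by
  by_contra hne
  have hsk := aux_skew n s g (hΓIso hg) (hWolf g hg)
  have hsk' := aux_skew n s g' (hΓIso hg') (hWolf g' hg')
  have hmul : linA n (g * g') = linA n g + linA n g' + linA n g ∘ₗ linA n g' := by
    refine LinearMap.ext fun z => ?_
    have e : (g * g').linear z = g.linear (g'.linear z) := rfl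
    simp only [linA, LinearMap.sub_apply, LinearMap.add_apply, LinearMap.comp_apply,
      LinearEquiv.coe_coe, LinearMap.id_apply, e, map_sub]
    abel
  have hsq := (hWolf _ (Γ.mul_mem hg hg')).1
  have hA := (hWolf g hg).1
  have hA' := (hWolf g' hg').1
  have hiso := (hWolf g hg).2.2.1
  rw [hmul] at hsq
  set A : Module.End ℝ (E n) := linA n g with hAdef
  set A' : Module.End ℝ (E n) := linA n g' with hAdef'
  obtain ⟨hac, h3⟩ := aux_ring A A' hA hA' hsq
  have hac1 : ∀ z, A (A' z) = - A' (A z) := fun z => LinearMap.congr_fun hac z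
  have h31 : ∀ z, A' (A (A' z)) = 0 := fun z => LinearMap.congr_fun h3 z
  have halt : ∀ z w, B n s (A (A' z)) w = - B n s (A (A' w)) z := by
    intro z w
    rw [hsk, hsk', hac1 w, aux_B_symm n s z]
    simp
  have halt0 : ∀ z, B n s (A (A' z)) z = 0 := fun z => by linarith [halt z z]
  have hind : ∀ a b : ℝ, a • A (A' x) + b • A (A' y) = 0 → a = 0 ∧ b = 0 := by
    intro a b hab
    have e1 : B n s (a • A (A' x) + b • A (A' y)) y = 0 := by rw [hab]; simp
    have e2 : B n s (a • A (A' x) + b • A (A' y)) x = 0 := by rw [hab]; simp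
    simp only [map_add, map_smul, LinearMap.add_apply, LinearMap.smul_apply, halt0,
      smul_eq_mul, halt y x, mul_zero, add_zero, zero_add, mul_neg, neg_eq_zero] at e1 e2
    exact ⟨(mul_eq_zero.1 e1).resolve_right hne, (mul_eq_zero.1 e2).resolve_right hne⟩
  let L : (Fin 4 → ℝ) →ₗ[ℝ] E n := A ∘ₗ Fintype.linearCombination ℝ ![x, y, A' x, A' y]
  obtain ⟨c, hc0, hc⟩ := aux_index n s hs L (fun c => hiso _ ⟨_, rfl⟩ _ ⟨_, rfl⟩)
  have hc' : c 0 • A x + c 1 • A y + c 2 • A (A' x) + c 3 • A (A' y) = 0 := by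
    rw [← hc]
    simp [L, Fintype.linearCombination_apply, Fin.sum_univ_four]
  have hc'' := congrArg A' hc'
  simp only [map_add, map_smul, h31, smul_zero, add_zero, map_zero] at hc''
  obtain ⟨h0, h1⟩ := hind (c 0) (c 1) (by
    rw [hac1, hac1, smul_neg, smul_neg, ← neg_add, hc'', neg_zero])
  rw [h0, h1] at hc'
  obtain ⟨h2, h3⟩ := hind (c 2) (c 3) (by simpa using hc')
  apply hc0
  funext i
  fin_cases i <;> assumption

/-- If `Γ ⊆ Iso(ℝⁿ_s)` is a subgroup with the Wolf properties whose
centraliser in `Iso(ℝⁿ_s)` has an open orbit `D`, and `s ≤ 3`, then `D` is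
translationally isotropic. -/
theorem low_index_translationally_isotropic
    (n s : ℕ) (hn : 1 ≤ n) (hs : s ≤ n)
    (Γ : Subgroup (Aff n)) (hΓIso : (Γ : Set (Aff n)) ⊆ Iso n s)
    (hWolf : ∀ γ ∈ Γ, WolfElt n s γ)
    (D : Set (E n)) (p : E n)
    (hD : D = (fun g => g p) '' CentrIso n s Γ)
    (hDopen : IsOpen D)
    (hsle : s ≤ 3) :
    TranslationallyIsotropic n s D := by
  have hrefl : (B n s).IsRefl := fun x y h => by rw [aux_B_symm]; exact h
  have hnd : (B n s).Nondegenerate := by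
    refine (LinearMap.IsRefl.nondegenerate_iff_separatingLeft hrefl).2 ?_
    exact fun x h => aux_B_nondeg n s x h
  have hUiso : UGamma n Γ ≤ (B n s).orthogonal (UGamma n Γ) := by
    have key : ∀ g ∈ Γ, ∀ x, linA n g x ∈ (B n s).orthogonal (UGamma n Γ) := by
      intro g hg x
      have hle : UGamma n Γ ≤ LinearMap.ker ((B n s) (linA n g x)) := by
        refine iSup₂_le fun g' hg' => ?_
        rintro _ ⟨y, rfl⟩
        rw [LinearMap.mem_ker, aux_B_symm,
          aux_skew n s g' (hΓIso hg') (hWolf g' hg'), aux_B_symm,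
          aux_prod_zero n s hsle Γ hΓIso hWolf g' hg' g hg x y, neg_zero]
      rw [LinearMap.BilinForm.mem_orthogonal_iff]
      intro w hw
      exact hrefl _ _ (hle hw)
    refine iSup₂_le fun g hg => ?_
    rintro _ ⟨x, rfl⟩
    exact key g hg x
  have hT : ∀ u ∈ (B n s).orthogonal (UGamma n Γ), u ∈ TransSet n D := by
    intro u hu
    have hker : ∀ g ∈ Γ, g.linear u = u := by
      intro g hg
      have : u ∈ (LinearMap.ker (linA n g) : Set (E n)) := by
        rw [(hWolf g hg).2.2.2.2.2]
        intro w hw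
        rw [aux_B_symm]
        exact hu w ((le_iSup₂_of_le (f := fun γ (_ : γ ∈ Γ) => LinearMap.range (linA n γ))
          g hg le_rfl) hw)
      have h2 : linA n g u = 0 := this
      simpa [linA, sub_eq_zero] using h2
    intro x hx
    rw [hD] at hx ⊢
    obtain ⟨c, hc, rfl⟩ := hx
    refine ⟨τ n u * c, ⟨?_, ?_⟩, ?_⟩
    · intro a b
      exact hc.1 a b
    · intro γ hγ
      have h1 : τ n u * γ = γ * τ n u := by
        ext1 z
        have := γ.map_vadd z u
        simp only [vadd_eq_add, hker γ hγ] at this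
        simp only [AffineEquiv.coe_mul, Function.comp_apply, τ,
          AffineEquiv.constVAdd_apply, vadd_eq_add, this]
      rw [mul_assoc, hc.2 γ hγ, ← mul_assoc, h1, mul_assoc]
    · simp [τ, AffineEquiv.mul_def]
  intro w hw
  apply hT
  apply hUiso
  rw [← LinearMap.BilinForm.orthogonal_orthogonal hnd hrefl (UGamma n Γ)]
  intro u hu
  exact hrefl _ _ (hw u (hT u hu))

end
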